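/- Let (η(t)) be an irreducible continuous-time Markov chain on a finite state space, let η be a state and let Δ be a set of states not containing η. Then for any state ζ ∈ Δ, P_η[H_ζ = H^+_{Δ ∪ {η}}] = P_η[H_ζ = H_Δ] · P_η[H_Δ < H^+_η], where H_A is the hitting time of A and H^+_A the return time to A. -/

import Mathlib

open Finset

section ChainBasics

variable {E : Type*} [Fintype E] [DecidableEq E]

/-- The state occupied just before the `i`-th step of a finite path that starts at `η`
and then visits `w 0, w 1, …`. -/
def pstate (η : E) {n : ℕ} (w : Fin n → E) (i : Fin n) : E :=
  if (i : ℕ) = 0 then η else w ⟨(i : ℕ) - 1, lt_of_le_of_lt (Nat.sub_le _ _) i.isLt⟩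

/-- The probability (product of one-step transition probabilities of the jump chain `q`)
of the finite path starting at `η` and successively visiting `w 0, …, w (n-1)`. -/
noncomputable def pathP (q : E → E → ℝ) (η : E) {n : ℕ} (w : Fin n → E) : ℝ :=
  ∏ i : Fin n, q (pstate η w i) (w i)

open Classical in
/-- For a chain with one-step transition probabilities `q` started at `η`, the probability
that the first visit (at a step `≥ 1`) to the set `A` occurs at a state of `B`.
For `B ⊆ A`, this is the probability of the event `{H⁺_A = H_B}`. -/
noncomputable def firstHitIn (q : E → E → ℝ) (η : E) (B A : Finset E) : ℝ :=
  ∑' n : ℕ, ∑ w : Fin (n + 1) → E,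
    if (∀ i : Fin (n + 1), (i : ℕ) < n → w i ∉ A) ∧ w (Fin.last n) ∈ B
    then pathP q η w else 0

/-- `q` is a stochastic matrix. -/
def RowStochastic (q : E → E → ℝ) : Prop :=
  (∀ x y, 0 ≤ q x y) ∧ ∀ x, ∑ y, q x y = 1

/-- Irreducibility: any state can be reached from any state with positive probability. -/
def ChainIrreducible (q : E → E → ℝ) : Prop :=
  ∀ x y : E, ∃ (n : ℕ) (w : Fin (n + 1) → E), w (Fin.last n) = y ∧ 0 < pathP q x w

/-- The holding rate `λ(x) = ∑_y R(x,y)` of a continuous-time chain with jump rates `R`. -/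
noncomputable def lam (R : E → E → ℝ) (x : E) : ℝ := ∑ y, R x y

/-- The jump-chain transition probabilities of a continuous-time chain with rates `R`. -/
noncomputable def jmp (R : E → E → ℝ) (x y : E) : ℝ := R x y / lam R x

/-- The capacity `Cap(A,B) = ∑_{a∈A} μ(a) λ(a) P_a[H_B < H⁺_A]` of a continuous-time
chain with jump rates `R` and measure `μ`. -/
noncomputable def capac (R : E → E → ℝ) (μ : E → ℝ) (A B : Finset E) : ℝ :=
  ∑ a ∈ A, μ a * lam R a * firstHitIn (jmp R) a B (A ∪ B)

open Classical in
/-- The jump rates of the trace on `A` of a continuous-time chain with jump rates `R`: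
`R_A(a,b) = λ(a) P_a[H⁺_A = H_b]` for `a ≠ b` in `A`. -/
noncomputable def traceRate (R : E → E → ℝ) (A : Finset E) (a b : E) : ℝ :=
  if a ∈ A ∧ b ∈ A ∧ a ≠ b then lam R a * firstHitIn (jmp R) a {b} A else 0

end ChainBasics

section FirstHit

variable {E : Type*}

theorem pathP_cons (q : E → E → ℝ) (x y : E) {n : ℕ} (w : Fin n → E) :
    pathP q x (Fin.cons y w : Fin (n + 1) → E) = q x y * pathP q y w := by
  unfold pathP
  rw [Fin.prod_univ_succ]
  congr 1
  refine Finset.prod_congr rfl fun i _ => ?_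
  rw [Fin.cons_succ]
  congr 1
  obtain ⟨i, hi⟩ := i
  cases i with
  | zero => simp [pstate]
  | succ k =>
    simp only [pstate, Fin.succ_mk, Nat.add_eq_zero_iff, one_ne_zero, and_false, if_false,
      Nat.add_sub_cancel]
    exact Fin.cons_succ (α := fun _ => E) y w ⟨k, by omega⟩

/-- A set of states that the chain cannot leave contains the endpoint of every path of positive
probability that starts in it. -/
theorem last_mem_of_pathP_pos {q : E → E → ℝ} (hq : ∀ x y, 0 ≤ q x y) {S : Set E}
    (hS : ∀ x ∈ S, ∀ y, 0 < q x y → y ∈ S) {n : ℕ} :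
    ∀ {x : E} {w : Fin (n + 1) → E}, x ∈ S → 0 < pathP q x w → w (Fin.last n) ∈ S := by
  induction n with
  | zero =>
    intro x w hx hw
    refine hS x hx _ ?_
    simpa [pathP, pstate] using hw
  | succ n ih =>
    intro x w hx hw
    rw [← Fin.cons_self_tail w, pathP_cons] at hw
    have h0 : 0 < q x (w 0) :=
      (hq x (w 0)).lt_of_ne fun h => by simp [← h] at hw
    exact ih (w := Fin.tail w) (hS x hx _ h0) (pos_of_mul_pos_right hw h0.le)

variable [Fintype E] [DecidableEq E]

open Classical in
/-- The probability that the first visit to `A` occurs at step `n + 1`, at a state of `B`. -/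
noncomputable def firstHitAt (q : E → E → ℝ) (B A : Finset E) (n : ℕ) (x : E) : ℝ :=
  ∑ w : Fin (n + 1) → E,
    if (∀ i : Fin (n + 1), (i : ℕ) < n → w i ∉ A) ∧ w (Fin.last n) ∈ B
    then pathP q x w else 0

theorem firstHitAt_zero (q : E → E → ℝ) (B A : Finset E) (x : E) :
    firstHitAt q B A 0 x = ∑ y ∈ B, q x y := by
  unfold firstHitAt
  rw [← (Equiv.funUnique (Fin 1) E).symm.sum_comp]
  simp [pathP, pstate, Finset.sum_ite_mem]

theorem firstHitAt_succ (q : E → E → ℝ) (B A : Finset E) (n : ℕ) (x : E) :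
    firstHitAt q B A (n + 1) x = ∑ y ∈ Aᶜ, q x y * firstHitAt q B A n y := by
  unfold firstHitAt
  rw [← (Fin.consEquiv fun _ : Fin (n + 2) => E).sum_comp, Fintype.sum_prod_type,
    ← Finset.sum_subset (Finset.subset_univ Aᶜ)]
  · refine Finset.sum_congr rfl fun y hy => ?_
    rw [Finset.mul_sum]
    refine Finset.sum_congr rfl fun w _ => ?_
    rw [Finset.mem_compl] at hy
    simp [Fin.consEquiv, Fin.forall_fin_succ (n := n + 1), ← Fin.succ_last, pathP_cons, hy]
  · intro y _ hy
    rw [Finset.mem_compl, not_not] at hy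
    refine Finset.sum_eq_zero fun w _ => ?_
    simp [Fin.consEquiv, Fin.forall_fin_succ (n := n + 1), hy]

variable {q : E → E → ℝ} {A B : Finset E}

theorem firstHitAt_nonneg (hq : RowStochastic q) (n : ℕ) (x : E) :
    0 ≤ firstHitAt q B A n x := by
  induction n generalizing x with
  | zero =>
    rw [firstHitAt_zero]
    exact Finset.sum_nonneg fun y _ => hq.1 x y
  | succ n ih =>
    rw [firstHitAt_succ]
    exact Finset.sum_nonneg fun y _ => mul_nonneg (hq.1 x y) (ih y)

theorem sum_firstHitAt_le_one (hq : RowStochastic q) (hBA : B ⊆ A) (n : ℕ) (x : E) :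
    ∑ k ∈ Finset.range n, firstHitAt q B A k x ≤ 1 := by
  induction n generalizing x with
  | zero => simp
  | succ n ih =>
    rw [Finset.sum_range_succ', firstHitAt_zero]
    simp only [firstHitAt_succ]
    rw [Finset.sum_comm, ← hq.2 x, ← Finset.sum_compl_add_sum A]
    refine add_le_add (Finset.sum_le_sum fun y _ => ?_)
      (Finset.sum_le_sum_of_subset_of_nonneg hBA fun y _ _ => hq.1 x y)
    rw [← Finset.mul_sum]
    exact mul_le_of_le_one_right (hq.1 x y) (ih y)

theorem summable_firstHitAt (hq : RowStochastic q) (hBA : B ⊆ A) (x : E) :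
    Summable fun n => firstHitAt q B A n x :=
  summable_of_sum_range_le (fun n => firstHitAt_nonneg hq n x)
    fun n => sum_firstHitAt_le_one hq hBA n x

/-- First-step decomposition of the hitting probabilities. -/
theorem firstHitIn_eq (hq : RowStochastic q) (hBA : B ⊆ A) (x : E) :
    firstHitIn q x B A = ∑ y ∈ B, q x y + ∑ y ∈ Aᶜ, q x y * firstHitIn q y B A := by
  change ∑' n, firstHitAt q B A n x =
    ∑ y ∈ B, q x y + ∑ y ∈ Aᶜ, q x y * ∑' n, firstHitAt q B A n y
  rw [(summable_firstHitAt hq hBA x).tsum_eq_zero_add, firstHitAt_zero]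
  simp only [firstHitAt_succ]
  rw [Summable.tsum_finsetSum fun y _ => (summable_firstHitAt hq hBA y).mul_left _]
  simp only [tsum_mul_left]

/-- Uniqueness for the Dirichlet problem: a function that is harmonic off a nonempty set `A`, with
zero boundary values on `A`, vanishes. -/
theorem eq_zero_of_killed_harmonic (hq : RowStochastic q) (hirr : ChainIrreducible q)
    (hA : A.Nonempty) {d : E → ℝ} (hd : ∀ x, d x = ∑ y ∈ Aᶜ, q x y * d y) (x : E) :
    d x = 0 := by
  obtain ⟨a, ha⟩ := hA
  have : Nonempty E := ⟨a⟩
  obtain ⟨m, hm⟩ := Finite.exists_max fun z => |d z|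
  by_contra hx
  have hpos : 0 < |d m| := (abs_pos.mpr hx).trans_le (hm x)
  have hclosed : ∀ z ∈ {z | |d z| = |d m|}, ∀ y, 0 < q z y →
      y ∈ {z | z ∉ A ∧ |d z| = |d m|} := by
    intro z hz y hy
    have h1 : |d m| ≤ ∑ y, q z y * (if y ∈ A then 0 else |d y|) := by
      rw [← show |d z| = |d m| from hz, hd z]
      refine (Finset.abs_sum_le_sum_abs _ _).trans (le_of_eq ?_)
      rw [← Finset.sum_subset (Finset.subset_univ Aᶜ)]
      · refine Finset.sum_congr rfl fun y hy => ?_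
        rw [if_neg (Finset.mem_compl.mp hy), abs_mul, abs_of_nonneg (hq.1 z y)]
      · intro y _ hy
        rw [if_pos (by simpa using hy), mul_zero]
    have hle : ∀ y, (if y ∈ A then 0 else |d y|) ≤ |d m| := by
      intro y
      split_ifs
      exacts [hpos.le, hm y]
    have h2 : ∑ y, q z y * (|d m| - if y ∈ A then 0 else |d y|) ≤ 0 := by
      simp only [mul_sub, Finset.sum_sub_distrib, ← Finset.sum_mul, hq.2 z]
      linarith
    have h3 := Finset.single_le_sum
      (f := fun y => q z y * (|d m| - if y ∈ A then 0 else |d y|))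
      (fun y _ => mul_nonneg (hq.1 z y) (sub_nonneg.mpr (hle y))) (Finset.mem_univ y)
    have h4 : |d m| - (if y ∈ A then 0 else |d y|) ≤ 0 :=
      nonpos_of_mul_nonpos_right (h3.trans h2) hy
    by_cases hyA : y ∈ A
    · rw [if_pos hyA] at h4
      linarith
    · rw [if_neg hyA] at h4
      exact ⟨hyA, le_antisymm (hm y) (by linarith)⟩
  have hstep : ∃ y, 0 < q m y := by
    by_contra! h
    have := Finset.sum_nonpos fun y (_ : y ∈ Finset.univ) => h y
    rw [hq.2 m] at this
    linarith
  obtain ⟨y, hy⟩ := hstep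
  obtain ⟨n, w, hw, hp⟩ := hirr y a
  have hmem := last_mem_of_pathP_pos hq.1
    (S := {z | z ∉ A ∧ |d z| = |d m|}) (fun z hz => hclosed z hz.2) (hclosed m rfl y hy) hp
  rw [hw] at hmem
  exact hmem.1 ha

end FirstHit

/-- for an irreducible finite-state Markov chain, a state `η` and a set of
states `Δ` with `η ∉ Δ`, and any `ζ ∈ Δ`:
`P_η[H_ζ = H⁺_{Δ∪{η}}] = P_η[H_ζ = H_Δ] ⬝ P_η[H_Δ < H⁺_η]`.
Hitting probabilities (which depend only on the embedded jump chain `q`) are expressed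
through `firstHitIn`: the first visit (at a step `≥ 1`) to `Δ ∪ {η}` occurs at `ζ`, the
first visit to `Δ` occurs at `ζ`, and the chain visits `Δ` before returning to `η`. -/
theorem hitting_time_decomposition {E : Type*} [Fintype E] [DecidableEq E]
    (q : E → E → ℝ) (hq : RowStochastic q) (hirr : ChainIrreducible q)
    (Δ : Finset E) (η ζ : E) (hη : η ∉ Δ) (hζ : ζ ∈ Δ) :
    firstHitIn q η {ζ} (insert η Δ) =
      firstHitIn q η {ζ} Δ * firstHitIn q η Δ (insert η Δ) := by
  have hη' : η ∈ Δᶜ := Finset.mem_compl.mpr hη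
  have hcompl : (insert η Δ)ᶜ = Δᶜ.erase η := Finset.compl_insert
  have hne : (insert η Δ).Nonempty := Finset.insert_nonempty η Δ
  have hsub : {η} ⊆ insert η Δ := by simp
  have hζΔ : {ζ} ⊆ Δ := Finset.singleton_subset_iff.mpr hζ
  have hsub' : {ζ} ⊆ insert η Δ := hζΔ.trans (Finset.subset_insert η Δ)
  have htotal := eq_zero_of_killed_harmonic hq hirr hne
    (d := fun x => 1 - firstHitIn q x Δ (insert η Δ) - firstHitIn q x {η} (insert η Δ))
    (fun x => by
      have hsum := hq.2 x
      rw [← Finset.sum_compl_add_sum (insert η Δ), Finset.sum_insert hη] at hsum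
      rw [firstHitIn_eq hq (Finset.subset_insert η Δ), firstHitIn_eq hq hsub]
      simp only [mul_sub, Finset.sum_sub_distrib, mul_one, Finset.sum_singleton]
      linarith) η
  have hsplit := eq_zero_of_killed_harmonic hq hirr hne
    (d := fun x => firstHitIn q x {ζ} Δ - firstHitIn q x {ζ} (insert η Δ)
      - firstHitIn q x {η} (insert η Δ) * firstHitIn q η {ζ} Δ)
    (fun x => by
      have h := firstHitIn_eq hq hζΔ x
      rw [← Finset.add_sum_erase _ _ hη', ← hcompl] at h
      rw [h, firstHitIn_eq hq hsub' x, firstHitIn_eq hq hsub x]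
      simp only [mul_sub, Finset.sum_sub_distrib, Finset.sum_singleton, add_mul,
        Finset.sum_mul, mul_assoc]
      ring) η
  linear_combination firstHitIn q η {ζ} Δ * htotal - hsplit
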